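/- Fix i with 1 ≤ i ≤ k and j with 1 ≤ j ≤ r_i. If v ∈ ℂⁿ is a generalized eigenvector of A corresponding to λ_i (i.e., v ≠ 0 and (A − λ_i I)^{r_i} v = 0) and v lies in the image of (A − λ_i I)^{j−1} (i.e., v = (A − λ_i I)^{j−1} w for some w ∈ ℂⁿ), then v belongs to the column space of the matrix B_{i,j}, i.e., v = B_{i,j} x for some x ∈ ℂⁿ. -/

import Mathlib

open Matrix Polynomial

lemma pf_unique (k : ℕ) (lam : Fin k → ℂ) (hlam : Function.Injective lam) (r : Fin k → ℕ)
    (c : Fin k → ℕ → ℂ)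
    (h : ∀ s : ℂ, (∀ i, s ≠ lam i) →
      ∑ i, ∑ j ∈ Finset.Icc 1 (r i), ((s - lam i) ^ j)⁻¹ * c i j = 0)
    (i : Fin k) (j : ℕ) (h1 : 1 ≤ j) (h2 : j ≤ r i) : c i j = 0 := by
  classical
  let p : Fin k → ℂ[X] := fun i => ∑ j ∈ Finset.Icc 1 (r i), C (c i j) * (X - C (lam i)) ^ (r i - j)
  let Q : Fin k → ℂ[X] := fun i => ∏ l ∈ Finset.univ.erase i, (X - C (lam l)) ^ r l
  have hP : ∑ i, p i * Q i = 0 := by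
    apply Polynomial.eq_zero_of_infinite_isRoot
    have hfin : (Set.range lam).Finite := Set.finite_range lam
    refine hfin.infinite_compl.mono ?_
    intro s hs
    have hs' : ∀ i, s ≠ lam i := fun i e => hs ⟨i, e.symm⟩
    have e := congrArg (fun z => (∏ l, (s - lam l) ^ r l) * z) (h s hs')
    simp only [mul_zero, Finset.mul_sum] at e
    simp only [Set.mem_ofPred_eq, IsRoot.def, eval_finsetSum, p, Q, eval_mul, eval_prod, eval_pow,
      eval_sub, eval_X, eval_C, Finset.sum_mul]
    rw [← e]
    refine Finset.sum_congr rfl fun i _ => Finset.sum_congr rfl fun j hj => ?_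
    rw [Finset.mem_Icc] at hj
    rw [← Finset.mul_prod_erase Finset.univ _ (Finset.mem_univ i)]
    have hne : s - lam i ≠ 0 := sub_ne_zero.mpr (hs' i)
    have : (s - lam i) ^ r i = (s - lam i) ^ (r i - j) * (s - lam i) ^ j := by
      rw [← pow_add]; congr 1; omega
    rw [this]
    field_simp
  have hdvd : (X - C (lam i)) ^ r i ∣ p i * Q i := by
    rw [← Finset.add_sum_erase _ _ (Finset.mem_univ i)] at hP
    rw [eq_neg_of_add_eq_zero_left hP, dvd_neg]
    refine Finset.dvd_sum fun l hl => Dvd.dvd.mul_left ?_ _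
    exact Finset.dvd_prod_of_mem (fun l => (X - C (lam l)) ^ r l)
      (Finset.mem_erase.mpr ⟨(Finset.ne_of_mem_erase hl).symm, Finset.mem_univ _⟩)
  have hcop : IsCoprime ((X - C (lam i)) ^ r i) (Q i) := by
    refine IsCoprime.prod_right fun l hl => IsCoprime.pow ?_
    exact isCoprime_X_sub_C_of_isUnit_sub
      (sub_ne_zero.mpr (fun e => (Finset.ne_of_mem_erase hl) (hlam e).symm)).isUnit
  have hd := hcop.dvd_of_dvd_mul_right hdvd
  have hp0 : p i = 0 := by
    refine Polynomial.eq_zero_of_dvd_of_degree_lt hd ?_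
    rw [degree_pow, degree_X_sub_C, nsmul_one]
    refine (degree_sum_le _ _).trans_lt ?_
    rw [Finset.sup_lt_iff (WithBot.bot_lt_coe _)]
    intro j hj
    rw [Finset.mem_Icc] at hj
    rw [← smul_eq_C_mul]
    refine (degree_smul_le _ _).trans_lt ?_
    rw [degree_pow, degree_X_sub_C, nsmul_one]
    exact Nat.cast_lt.mpr (by omega)
  have hc := congrArg (fun q => (q.comp (X + C (lam i))).coeff (r i - j)) hp0
  simp only [p, Polynomial.sum_comp, mul_comp, C_comp, pow_comp, sub_comp, X_comp, add_sub_cancel_right,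
    finsetSum_coeff, coeff_C_mul_X_pow, zero_comp, coeff_zero] at hc
  rw [Finset.sum_eq_single j] at hc
  · simpa using hc
  · intro b hb hbj
    rw [Finset.mem_Icc] at hb
    rw [if_neg (by omega)]
  · intro hj
    exact absurd (Finset.mem_Icc.mpr ⟨h1, h2⟩) hj

lemma ker_stab (n k : ℕ) (A : Matrix (Fin n) (Fin n) ℂ)
    (lam : Fin k → ℂ) (hlam : Function.Injective lam) (r : Fin k → ℕ)
    (hchar : A.charpoly = ∏ i, (X - C (lam i)) ^ r i) (i : Fin k) (m : ℕ) (w : Fin n → ℂ)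
    (hw : ((A - lam i • (1 : Matrix (Fin n) (Fin n) ℂ)) ^ m).mulVec w = 0) :
    ((A - lam i • (1 : Matrix (Fin n) (Fin n) ℂ)) ^ r i).mulVec w = 0 := by
  classical
  have hcop : IsCoprime (∏ l ∈ Finset.univ.erase i, (X - C (lam l)) ^ r l)
      ((X - C (lam i)) ^ m) := by
    refine IsCoprime.prod_left fun l hl => IsCoprime.pow ?_
    exact isCoprime_X_sub_C_of_isUnit_sub
      (sub_ne_zero.mpr (fun e => (Finset.ne_of_mem_erase hl) (hlam e))).isUnit
  obtain ⟨a, b, hab⟩ := hcop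
  have hN : aeval A (X - C (lam i)) = A - lam i • (1 : Matrix (Fin n) (Fin n) ℂ) := by
    simp [Algebra.algebraMap_eq_smul_one]
  have key : (X - C (lam i)) ^ r i = a * A.charpoly
      + ((X - C (lam i)) ^ r i * b) * (X - C (lam i)) ^ m := by
    rw [hchar, ← Finset.mul_prod_erase Finset.univ _ (Finset.mem_univ i)]
    linear_combination (-(X - C (lam i)) ^ r i) * hab
  have := congrArg (aeval A) key
  rw [map_add, map_mul, Matrix.aeval_self_charpoly, mul_zero, zero_add, map_mul, map_pow, map_pow,
    hN] at this
  rw [this, ← Matrix.mulVec_mulVec, hw, Matrix.mulVec_zero]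

lemma resolvent_apply (n k : ℕ) (A : Matrix (Fin n) (Fin n) ℂ)
    (lam : Fin k → ℂ) (r : Fin k → ℕ)
    (hchar : A.charpoly = ∏ i, (X - C (lam i)) ^ r i) (i : Fin k) (w : Fin n → ℂ)
    (hw : ((A - lam i • (1 : Matrix (Fin n) (Fin n) ℂ)) ^ r i).mulVec w = 0)
    (s : ℂ) (hs : ∀ i, s ≠ lam i) :
    (s • (1 : Matrix (Fin n) (Fin n) ℂ) - A)⁻¹.mulVec w =
      ∑ j ∈ Finset.Icc 1 (r i), ((s - lam i) ^ j)⁻¹ •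
        ((A - lam i • (1 : Matrix (Fin n) (Fin n) ℂ)) ^ (j - 1)).mulVec w := by
  have hdet : IsUnit (s • (1 : Matrix (Fin n) (Fin n) ℂ) - A).det := by
    have h1 : (s • (1 : Matrix (Fin n) (Fin n) ℂ) - A).det = A.charpoly.eval s := by
      rw [Matrix.eval_charpoly, Matrix.scalar_apply, Matrix.smul_one_eq_diagonal]
    rw [h1, hchar, eval_prod, isUnit_iff_ne_zero, Finset.prod_ne_zero_iff]
    intro l _
    simpa using fun h : s - lam l = 0 => absurd (sub_eq_zero.mp h) (hs l)
  set N := A - lam i • (1 : Matrix (Fin n) (Fin n) ℂ) with hN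
  have hne : s - lam i ≠ 0 := sub_ne_zero.mpr (hs i)
  have hsA : s • (1 : Matrix (Fin n) (Fin n) ℂ) - A = (s - lam i) • 1 - N := by
    rw [hN, sub_smul]; abel
  have tel : ∀ m : ℕ, (s • (1 : Matrix (Fin n) (Fin n) ℂ) - A).mulVec
      (∑ j ∈ Finset.Icc 1 m, ((s - lam i) ^ j)⁻¹ • (N ^ (j - 1)).mulVec w)
      = w - ((s - lam i) ^ m)⁻¹ • (N ^ m).mulVec w := by
    intro m
    induction m with
    | zero => simp
    | succ m ih =>
      rw [Finset.sum_Icc_succ_top (by omega), Matrix.mulVec_add, ih, hsA, Matrix.mulVec_smul,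
        Matrix.sub_mulVec, Matrix.smul_mulVec, Matrix.one_mulVec, Matrix.mulVec_mulVec,
        Nat.add_sub_cancel, ← pow_succ', smul_sub, smul_smul]
      have : ((s - lam i) ^ (m + 1))⁻¹ * (s - lam i) = ((s - lam i) ^ m)⁻¹ := by
        rw [pow_succ]; field_simp
      rw [this]; abel
  have t := tel (r i)
  rw [hw, smul_zero, sub_zero] at t
  conv_lhs => rw [← t]
  rw [Matrix.mulVec_mulVec, Matrix.nonsing_inv_mul _ hdet, Matrix.one_mulVec]



/-- A generalized eigenvector for `lam i` lying in the image of `(A - lam i I)^(j-1)` belongs to the column space of `B i j`. -/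
theorem generalized_eigenvector_in_column_space
    (n k : ℕ) (hn : 1 ≤ n)
    (A : Matrix (Fin n) (Fin n) ℂ)
    (lam : Fin k → ℂ) (hlam : Function.Injective lam)
    (r : Fin k → ℕ) (hr : ∀ i, 1 ≤ r i)
    (hsum : ∑ i, r i = n)
    (hchar : A.charpoly = ∏ i, (X - C (lam i)) ^ r i)
    (B : Fin k → ℕ → Matrix (Fin n) (Fin n) ℂ)
    (hB : ∀ s : ℂ, (∀ i, s ≠ lam i) →
      (s • (1 : Matrix (Fin n) (Fin n) ℂ) - A)⁻¹
        = ∑ i, ∑ j ∈ Finset.Icc 1 (r i), ((s - lam i) ^ j)⁻¹ • B i j)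
    :
    ∀ i : Fin k, ∀ j : ℕ, 1 ≤ j → j ≤ r i →
      ∀ v : Fin n → ℂ, v ≠ 0 →
        ((A - lam i • (1 : Matrix (Fin n) (Fin n) ℂ)) ^ r i).mulVec v = 0 →
        (∃ w : Fin n → ℂ,
          ((A - lam i • (1 : Matrix (Fin n) (Fin n) ℂ)) ^ (j - 1)).mulVec w = v) →
        ∃ x : Fin n → ℂ, (B i j).mulVec x = v := by
  intro i j h1 h2 v _ hv hex
  obtain ⟨w, hw⟩ := hex
  refine ⟨w, ?_⟩
  have hw0 : ((A - lam i • (1 : Matrix (Fin n) (Fin n) ℂ)) ^ r i).mulVec w = 0 := by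
    apply ker_stab n k A lam hlam r hchar i (r i + (j - 1)) w
    rw [pow_add, ← Matrix.mulVec_mulVec, hw, hv]
  rw [← hw]
  funext a
  classical
  have := pf_unique k lam hlam r
    (fun l m => (B l m).mulVec w a - if l = i then
      ((A - lam i • (1 : Matrix (Fin n) (Fin n) ℂ)) ^ (m - 1)).mulVec w a else 0) ?_ i j h1 h2
  · simpa [sub_eq_zero] using this
  · intro s hs
    have e := resolvent_apply n k A lam r hchar i w hw0 s hs
    rw [hB s hs] at e
    have e' := congrFun e a
    simp only [Matrix.sum_mulVec, Matrix.smul_mulVec, Finset.sum_apply, Pi.smul_apply,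
      smul_eq_mul] at e'
    simp only [mul_sub, Finset.sum_sub_distrib]
    rw [e', sub_eq_zero, Finset.sum_eq_single i]
    · simp
    · intro b _ hb
      simp [hb]
    · simp
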